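/- Let $n\ge 1$, $0\le\alpha<n$, and let $p:\mathbb{R}^n\to(0,\infty)$, with $p_-=\inf p$ and $p_+=\sup p$, satisfy $0<p_-\le p_+<\frac{n}{\alpha}$ (read as $p_+<\infty$ when $\alpha=0$). Assume that $p$ satisfies the local log-Hölder condition: there is $c>0$ with $|p(x)-p(y)|\le \frac{c}{-\log|x-y|}$ whenever $|x-y|<\frac12$; and the log-Hölder condition at infinity: there are $C_\infty>0$ and $p_\infty\in\mathbb{R}$ with $|p(x)-p_\infty|\le\frac{C_\infty}{\log(e+|x|)}$ for all $x\in\mathbb{R}^n$. Define $q:\mathbb{R}^n\to(0,\infty)$ by $\frac{1}{q(x)}=\frac{1}{p(x)}-\frac{\alpha}{n}$. For an exponent $s:\mathbb{R}^n\to(0,\infty)$ and a measurable $f:\mathbb{R}^n\to[0,\infty]$ put $\|f\|_{s(\cdot)}=\inf\{\lambda>0:\int_{\mathbb{R}^n}(f(x)/\lambda)^{s(x)}\,dx\le 1\}\in[0,\infty]$ (with $\inf\emptyset=\infty$), let $\underline{s}=\min(\inf s,1)$, and for nonnegative numbers $\{\lambda_j\}_{j=1}^\infty$ and cubes $\{Q_j\}_{j=1}^\infty$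 (with sides parallel to the axes and positive side lengths) put $$\mathcal{A}(\{\lambda_j\},\{Q_j\},s(\cdot))=\left\|\left(\sum_{j=1}^\infty\left(\frac{\lambda_j\chi_{Q_j}}{\|\chi_{Q_j}\|_{s(\cdot)}}\right)^{\underline{s}}\right)^{1/\underline{s}}\right\|_{s(\cdot)}\in[0,\infty],$$ where the series is summed in $[0,\infty]$. Then there is a constant $C\in(0,\infty)$, depending only on $n$, $\alpha$ and $p$, such that $$\mathcal{A}(\{\lambda_j\}_{j=1}^\infty,\{Q_j\}_{j=1}^\infty,q(\cdot))\le C\,\mathcal{A}(\{\lambda_j\}_{j=1}^\infty,\{Q_j\}_{j=1}^\infty,p(\cdot))$$ for all sequences of nonnegative numbers $\{\lambda_j\}_{j=1}^\infty$ and all sequences of cubes $\{Q_j\}_{j=1}^\infty$. -/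

import Mathlib

open MeasureTheory
open scoped NNReal ENNReal

noncomputable section

/-- Euclidean space `ℝⁿ`. -/
abbrev Rn (n : ℕ) := EuclideanSpace ℝ (Fin n)

/-- The variable Lebesgue quasinorm `‖f‖_{p(·)} = inf {l > 0 : ∫ |f(x)/l|^{p(x)} dx ≤ 1}` of a
nonnegative, possibly infinite valued, function; it is `∞` when no `l` is admissible. -/
def varLpNorm {n : ℕ} (p : Rn n → ℝ) (f : Rn n → ℝ≥0∞) : ℝ≥0∞ :=
  sInf {l : ℝ≥0∞ | 0 < l ∧ l < ∞ ∧ ∫⁻ x, (f x / l) ^ p x ≤ 1}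

/-- The local log-Hölder condition. -/
def LogHolderLocal {n : ℕ} (p : Rn n → ℝ) : Prop :=
  ∃ c : ℝ, 0 < c ∧ ∀ x y : Rn n, ‖x - y‖ < 1 / 2 → |p x - p y| ≤ c / (-Real.log ‖x - y‖)

/-- The log-Hölder condition at infinity. -/
def LogHolderInfty {n : ℕ} (p : Rn n → ℝ) : Prop :=
  ∃ C : ℝ, 0 < C ∧ ∃ pinf : ℝ, ∀ x : Rn n, |p x - pinf| ≤ C / Real.log (Real.exp 1 + ‖x‖)

/-- `p₋ = inf p`. -/
def pMinus {n : ℕ} (p : Rn n → ℝ) : ℝ := ⨅ x, p x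

/-- `p₊ = sup p` (used for `p` bounded above). -/
def pPlus {n : ℕ} (p : Rn n → ℝ) : ℝ := ⨆ x, p x

/-- `p̲ = min (p₋, 1)`. -/
def pUnder {n : ℕ} (p : Rn n → ℝ) : ℝ := min (pMinus p) 1

/-- The cube `Q(z,r)` centered at `z` with side length `r`. -/
def cube {n : ℕ} (z : Rn n) (r : ℝ) : Set (Rn n) := {x | ∀ i, |x i - z i| ≤ r / 2}

/-- The characteristic function of the cube `Q(z,r)`. -/
def cubeInd {n : ℕ} (z : Rn n) (r : ℝ) : Rn n → ℝ≥0∞ := (cube z r).indicator 1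

/-- The quantity `𝒜({λ_j},{Q_j},p(·))` for `Q_j = Q(z_j,r_j)`. The series is summed in `[0,∞]`. -/
def AFun {n : ℕ} (p : Rn n → ℝ) (lam : ℕ → ℝ≥0) (z : ℕ → Rn n) (r : ℕ → ℝ) : ℝ≥0∞ :=
  varLpNorm p fun x =>
    (∑' j, ((lam j : ℝ≥0∞) * cubeInd (z j) (r j) x / varLpNorm p (cubeInd (z j) (r j)))
      ^ pUnder p) ^ (1 / pUnder p)

end

theorem rpow_le_mul_rpow_add_of_log {a u v m C k E : ℝ} (ha : 0 < a) (ha1 : a ≤ 1) (hm : 0 < m)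
    (hu : m ≤ u) (hk : 0 ≤ k) (hE : 1 ≤ E) (h : |u - v| * Real.log E ≤ C) :
    a ^ u ≤ Real.exp (C * (k / m)) * a ^ v + E ^ (-k) := by
  have hlE : 0 ≤ Real.log E := Real.log_nonneg hE
  have hla : Real.log a ≤ 0 := Real.log_nonpos ha.le ha1
  have hN : 0 ≤ k / m := by positivity
  rcases le_total (-(k / m * Real.log E)) (Real.log a) with hc | hc
  · have h1 : a ^ u ≤ Real.exp (C * (k / m)) * a ^ v := by
      rw [Real.rpow_def_of_pos ha, Real.rpow_def_of_pos ha, ← Real.exp_add, Real.exp_le_exp]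
      have h2 : (u - v) * Real.log a ≤ |u - v| * (-Real.log a) := by
        have := neg_abs_le (u - v)
        nlinarith
      have h3 : |u - v| * (-Real.log a) ≤ |u - v| * (k / m * Real.log E) :=
        mul_le_mul_of_nonneg_left (by linarith) (abs_nonneg _)
      have h4 : |u - v| * Real.log E * (k / m) ≤ C * (k / m) := mul_le_mul_of_nonneg_right h hN
      nlinarith
    have : 0 ≤ E ^ (-k) := by positivity
    linarith
  · have h1 : a ^ u ≤ E ^ (-k) := by
      rw [Real.rpow_def_of_pos ha, Real.rpow_def_of_pos (by linarith), Real.exp_le_exp]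
      have h2 : Real.log a * u ≤ Real.log a * m := mul_le_mul_of_nonpos_left hu hla
      have h3 : Real.log a * m ≤ -(k / m * Real.log E) * m := mul_le_mul_of_nonneg_right hc hm.le
      have h4 : -(k / m * Real.log E) * m = Real.log E * -k := by field_simp
      linarith
    have : 0 ≤ Real.exp (C * (k / m)) * a ^ v := by positivity
    linarith

/-- The integrable weight `(1 + |y|)^{-(n+1)}`. -/
noncomputable def decayWeight {n : ℕ} (y : Rn n) : ℝ := (1 + ‖y‖) ^ (-((n : ℝ) + 1))

theorem decayWeight_nonneg {n : ℕ} (y : Rn n) : 0 ≤ decayWeight y := by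
  unfold decayWeight; positivity

theorem measurable_decayWeight {n : ℕ} : Measurable (decayWeight (n := n)) := by
  unfold decayWeight; fun_prop

theorem lintegral_decayWeight_lt_top {n : ℕ} :
    ∫⁻ y : Rn n, ENNReal.ofReal (decayWeight y) < ∞ := by
  have h := finite_integral_one_add_norm (E := Rn n) (μ := volume) (r := (n : ℝ) + 1)
    (by simp)
  simpa only [decayWeight] using h

theorem ennreal_rpow_le_mul_rpow_add {n : ℕ} {a : ℝ≥0∞} {u v m C : ℝ} (ha1 : a ≤ 1) (hm : 0 < m)
    (hu : m ≤ u) (y : Rn n) (h : |u - v| * Real.log (Real.exp 1 + ‖y‖) ≤ C) :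
    a ^ u ≤ ENNReal.ofReal (Real.exp (C * (((n : ℝ) + 1) / m))) * a ^ v
      + ENNReal.ofReal (decayWeight y) := by
  rcases eq_or_ne a 0 with rfl | h0
  · rw [ENNReal.zero_rpow_of_pos (by linarith)]; exact zero_le
  lift a to ℝ≥0 using (ne_top_of_le_ne_top ENNReal.one_ne_top ha1)
  have hpos : 0 < (a : ℝ) := by
    have : a ≠ 0 := by simpa using h0
    positivity
  have ha1' : (a : ℝ) ≤ 1 := by exact_mod_cast ha1
  have he : (1 : ℝ) ≤ Real.exp 1 := Real.one_le_exp (by norm_num)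
  have hE : 1 ≤ Real.exp 1 + ‖y‖ := by have := norm_nonneg y; linarith
  have key := rpow_le_mul_rpow_add_of_log hpos ha1' hm hu (k := (n : ℝ) + 1) (by positivity) hE h
  have hw : (Real.exp 1 + ‖y‖) ^ (-((n : ℝ) + 1)) ≤ decayWeight y := by
    unfold decayWeight
    apply Real.rpow_le_rpow_of_nonpos (by positivity) (by linarith)
    have : (0 : ℝ) ≤ n := by positivity
    linarith
  have hcoe : (a : ℝ≥0∞) = ENNReal.ofReal (a : ℝ) := by simp
  rw [hcoe, ENNReal.ofReal_rpow_of_pos hpos, ENNReal.ofReal_rpow_of_pos hpos,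
    ← ENNReal.ofReal_mul (by positivity), ← ENNReal.ofReal_add (by positivity)
      (decayWeight_nonneg y)]
  exact ENNReal.ofReal_le_ofReal (by linarith)

theorem ennreal_le_add_rpow_mul {F t : ℝ≥0∞} {P : ℝ} (hP : 1 ≤ P) (ht : t ≠ 0) (ht' : t ≠ ∞) :
    F ≤ t + F ^ P * t ^ (1 - P) := by
  rcases le_total F t with h | h
  · exact h.trans le_self_add
  have hF0 : F ≠ 0 := by rintro rfl; exact ht (le_antisymm h zero_le)
  refine le_trans ?_ le_add_self
  rcases eq_or_ne F ∞ with rfl | hF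
  · rw [ENNReal.top_rpow_of_pos (by linarith), ENNReal.top_mul]
    simp [ENNReal.rpow_eq_zero_iff, ht, ht']
  calc F = F ^ P * F ^ (1 - P) := by
        rw [← ENNReal.rpow_add _ _ hF0 hF]; simp
    _ ≤ F ^ P * t ^ (1 - P) := by
        refine mul_le_mul_right ?_ _
        rw [← neg_sub, ENNReal.rpow_neg, ENNReal.rpow_neg, ENNReal.inv_le_inv]
        exact ENNReal.rpow_le_rpow h (by linarith)

theorem measurableSet_cube {n : ℕ} (z : Rn n) (r : ℝ) : MeasurableSet (cube z r) := by
  have : cube z r = ⋂ i, {x : Rn n | |x i - z i| ≤ r / 2} := by ext; simp [cube]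
  rw [this]
  refine MeasurableSet.iInter fun i => ?_
  apply measurableSet_le <;> fun_prop

theorem volume_cube {n : ℕ} (z : Rn n) {r : ℝ} (hr : 0 ≤ r) :
    volume (cube z r) = ENNReal.ofReal (r ^ n) := by
  have h : cube z r = (WithLp.ofLp : Rn n → _) ⁻¹'
      (Set.Icc (fun i => z i - r / 2) (fun i => z i + r / 2)) := by
    ext x
    simp only [cube, Set.mem_ofPred_eq, Set.mem_preimage, Set.mem_Icc, Pi.le_def, abs_le]
    constructor
    · intro h; exact ⟨fun i => by linarith [(h i).1], fun i => by linarith [(h i).2]⟩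
    · rintro ⟨h1, h2⟩ i; exact ⟨by linarith [h1 i], by linarith [h2 i]⟩
  rw [h, (PiLp.volume_preserving_ofLp (Fin n)).measure_preimage
    measurableSet_Icc.nullMeasurableSet, Real.volume_Icc_pi]
  simp [ENNReal.ofReal_pow hr]

theorem norm_sub_le_of_mem_cube {n : ℕ} {z x : Rn n} {r : ℝ} (hx : x ∈ cube z r) :
    ‖x - z‖ ≤ n * (r / 2) := by
  have h : ‖x - z‖ ≤ ∑ i, ‖(x - z) i‖ := by
    have := EuclideanSpace.basisFun (Fin n) ℝ |>.sum_repr (x - z)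
    calc ‖x - z‖ = ‖∑ i, (EuclideanSpace.basisFun (Fin n) ℝ).repr (x - z) i
          • EuclideanSpace.basisFun (Fin n) ℝ i‖ := by rw [this]
      _ ≤ _ := by
        refine (norm_sum_le _ _).trans (Finset.sum_le_sum fun i _ => ?_)
        rw [norm_smul]; simp
  refine h.trans ((Finset.sum_le_sum (g := fun _ => r / 2) fun i _ => ?_).trans ?_)
  · simpa using hx i
  · simp

theorem measurable_cubeInd {n : ℕ} (z : Rn n) (r : ℝ) : Measurable (cubeInd z r) :=
  measurable_one.indicator (measurableSet_cube z r)

theorem lintegral_cubeInd {n : ℕ} (z : Rn n) {r : ℝ} (hr : 0 ≤ r) :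
    ∫⁻ x, cubeInd z r x = ENNReal.ofReal (r ^ n) := by
  unfold cubeInd
  rw [lintegral_indicator_one (measurableSet_cube z r), volume_cube z hr]

theorem cubeInd_of_mem {n : ℕ} {z x : Rn n} {r : ℝ} (h : x ∈ cube z r) : cubeInd z r x = 1 := by
  simp [cubeInd, h]

theorem cubeInd_of_notMem {n : ℕ} {z x : Rn n} {r : ℝ} (h : x ∉ cube z r) :
    cubeInd z r x = 0 := by
  simp [cubeInd, h]

/-- A bounded measurable exponent, log-Hölder at all scales up to one, with limit `pinf`. -/
structure LogHolderExp {n : ℕ} (p : Rn n → ℝ) (pinf : ℝ) : Prop where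
  measurable : Measurable p
  bounds : ∃ m M : ℝ, 0 < m ∧ (∀ x, m ≤ p x ∧ p x ≤ M) ∧ m ≤ pinf ∧ pinf ≤ M
  loc : ∃ D : ℝ, 0 ≤ D ∧ ∀ (x y : Rn n) (r : ℝ), 0 < r → r ≤ 1 → ‖x - y‖ ≤ 2 * n * r →
    |p x - p y| * (-Real.log r) ≤ D
  infty : ∃ C : ℝ, 0 ≤ C ∧ ∀ x : Rn n, |p x - pinf| * Real.log (Real.exp 1 + ‖x‖) ≤ C

theorem LogHolderExp.of_lipschitz {n : ℕ} {p p' : Rn n → ℝ} {pinf pinf' : ℝ}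
    (h : LogHolderExp p pinf) (hmeas : Measurable p')
    (hb : ∃ m M : ℝ, 0 < m ∧ (∀ x, m ≤ p' x ∧ p' x ≤ M) ∧ m ≤ pinf' ∧ pinf' ≤ M)
    {K : ℝ} (hK : 0 ≤ K) (hl : ∀ x y, |p' x - p' y| ≤ K * |p x - p y|)
    (hl' : ∀ x, |p' x - pinf'| ≤ K * |p x - pinf|) : LogHolderExp p' pinf' := by
  refine ⟨hmeas, hb, ?_, ?_⟩
  · obtain ⟨D, hD, h1⟩ := h.loc
    refine ⟨K * D, by positivity, fun x y r hr hr1 hxy => ?_⟩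
    have hlog : 0 ≤ -Real.log r := by have := Real.log_nonpos hr.le hr1; linarith
    calc _ ≤ K * |p x - p y| * (-Real.log r) := mul_le_mul_of_nonneg_right (hl x y) hlog
      _ = K * (|p x - p y| * (-Real.log r)) := by ring
      _ ≤ K * D := mul_le_mul_of_nonneg_left (h1 x y r hr hr1 hxy) hK
  · obtain ⟨C, hC, h1⟩ := h.infty
    refine ⟨K * C, by positivity, fun x => ?_⟩
    have hlog : 0 ≤ Real.log (Real.exp 1 + ‖x‖) := by
      apply Real.log_nonneg
      have := Real.one_le_exp (x := 1) (by norm_num)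
      have := norm_nonneg x
      linarith
    calc _ ≤ K * |p x - pinf| * Real.log (Real.exp 1 + ‖x‖) :=
          mul_le_mul_of_nonneg_right (hl' x) hlog
      _ = K * (|p x - pinf| * Real.log (Real.exp 1 + ‖x‖)) := by ring
      _ ≤ K * C := mul_le_mul_of_nonneg_left (h1 x) hK

theorem LogHolderLocal.continuous {n : ℕ} {p : Rn n → ℝ} (h : LogHolderLocal p) :
    Continuous p := by
  obtain ⟨c, hc, h⟩ := h
  rw [continuous_iff_continuousAt]
  intro x
  rw [Metric.continuousAt_iff]
  intro ε hε
  refine ⟨min (1 / 2) (Real.exp (-(c / ε) - 1)), by positivity, fun y hy => ?_⟩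
  rw [dist_eq_norm] at hy
  have h1 := h y x (hy.trans_le (min_le_left _ _))
  rw [Real.dist_eq]
  rcases eq_or_ne y x with rfl | hne
  · simpa using hε
  have hpos : 0 < ‖y - x‖ := norm_pos_iff.2 (sub_ne_zero.2 hne)
  have h2 : Real.log ‖y - x‖ < -(c / ε) - 1 := by
    rw [Real.log_lt_iff_lt_exp hpos]; exact hy.trans_le (min_le_right _ _)
  have h3 : 0 < c / ε := by positivity
  refine h1.trans_lt ?_
  rw [div_lt_iff₀ (by linarith)]
  have h4 : c = ε * (c / ε) := by field_simp
  nlinarith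

theorem LogHolderExp.of_logHolder {n : ℕ} (hn : 0 < n) {p : Rn n → ℝ} {m M : ℝ} (hm : 0 < m)
    (hb : ∀ x, m ≤ p x ∧ p x ≤ M) (hloc : LogHolderLocal p) (hinf : LogHolderInfty p) :
    ∃ pinf, m ≤ pinf ∧ pinf ≤ M ∧ LogHolderExp p pinf := by
  have hcont := hloc.continuous
  obtain ⟨c, hc, hloc⟩ := hloc
  obtain ⟨C, hC, pinf, hinf⟩ := hinf
  have hE : ∀ x : Rn n, 1 ≤ Real.log (Real.exp 1 + ‖x‖) := fun x => by
    rw [Real.le_log_iff_exp_le (by positivity)]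
    have := norm_nonneg x
    linarith
  have hlim : ∀ ε > 0, ∃ x : Rn n, |p x - pinf| ≤ ε := by
    intro ε hε
    have : Nonempty (Fin n) := ⟨⟨0, hn⟩⟩
    obtain ⟨x, hx⟩ := NormedSpace.exists_lt_norm ℝ (Rn n) (Real.exp (C / ε))
    refine ⟨x, (hinf x).trans ?_⟩
    have h0 := hE x
    rw [div_le_iff₀ (by linarith)]
    have : C / ε ≤ Real.log (Real.exp 1 + ‖x‖) := by
      rw [Real.le_log_iff_exp_le (by positivity)]
      have := Real.exp_pos 1
      linarith
    rw [div_le_iff₀ hε] at this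
    linarith
  have h1 : m ≤ pinf := by
    refine le_of_forall_pos_le_add fun ε hε => ?_
    obtain ⟨x, hx⟩ := hlim ε hε
    have := (abs_le.1 hx).2
    linarith [(hb x).1]
  have h2 : pinf ≤ M := by
    refine le_of_forall_pos_le_add fun ε hε => ?_
    obtain ⟨x, hx⟩ := hlim ε hε
    have := (abs_le.1 hx).1
    linarith [(hb x).2]
  refine ⟨pinf, h1, h2, hcont.measurable, ⟨m, M, hm, hb, h1, h2⟩, ?_, ?_⟩
  · set K : ℝ := 2 * n with hKdef
    have hK : 2 ≤ K := by
      have : (1 : ℝ) ≤ n := by exact_mod_cast hn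
      linarith
    have hlK : 0 ≤ Real.log K := Real.log_nonneg (by linarith)
    have hl2 : 0 < Real.log 2 := Real.log_pos (by norm_num)
    have hM : 0 < M := by linarith
    refine ⟨c + c * (Real.log K / Real.log 2) + M * Real.log (2 * K), ?_, ?_⟩
    · have : 0 ≤ Real.log (2 * K) := Real.log_nonneg (by linarith)
      positivity
    intro x y r hr hr1 hxy
    have hlr : 0 ≤ -Real.log r := by have := Real.log_nonpos hr.le hr1; linarith
    have hl2K : 0 ≤ Real.log (2 * K) := Real.log_nonneg (by linarith)
    rcases lt_or_ge (K * r) (1 / 2) with hs | hs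
    · suffices |p x - p y| * (-Real.log r) ≤ c + c * (Real.log K / Real.log 2) by
        have : 0 ≤ M * Real.log (2 * K) := by positivity
        linarith
      rcases eq_or_ne x y with rfl | hne
      · simp; positivity
      have hpos : 0 < ‖x - y‖ := norm_pos_iff.2 (sub_ne_zero.2 hne)
      have ha := hloc x y (by linarith)
      have hKr : 0 < K * r := by positivity
      have hlog : Real.log ‖x - y‖ ≤ Real.log (K * r) := Real.log_le_log hpos hxy
      have hlog2 : Real.log (K * r) ≤ -Real.log 2 := by
        rw [← Real.log_inv]
        exact Real.log_le_log hKr (by linarith)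
      have hmul : Real.log (K * r) = Real.log K + Real.log r :=
        Real.log_mul (by positivity) hr.ne'
      have hb' : |p x - p y| ≤ c / (-Real.log (K * r)) :=
        ha.trans (by gcongr; linarith)
      have hpos' : 0 < -Real.log (K * r) := by linarith
      calc |p x - p y| * (-Real.log r) ≤ c / (-Real.log (K * r)) * (-Real.log r) :=
            mul_le_mul_of_nonneg_right hb' hlr
        _ = c + c * (Real.log K / (-Real.log (K * r))) := by
            have : -Real.log r = -Real.log (K * r) + Real.log K := by linarith
            rw [this]
            generalize -Real.log (K * r) = A at hpos'
            field_simp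
        _ ≤ c + c * (Real.log K / Real.log 2) := by
            gcongr; linarith
    · have h3 : |p x - p y| ≤ M := by
        rw [abs_le]
        constructor <;> linarith [(hb x).1, (hb x).2, (hb y).1, (hb y).2]
      have h4 : -Real.log r ≤ Real.log (2 * K) := by
        rw [← Real.log_inv]
        apply Real.log_le_log (by positivity)
        rw [inv_le_iff_one_le_mul₀ hr]
        linarith
      have h5 : |p x - p y| * (-Real.log r) ≤ M * Real.log (2 * K) :=
        mul_le_mul h3 h4 hlr hM.le
      have : 0 ≤ c + c * (Real.log K / Real.log 2) := by positivity
      linarith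
  · refine ⟨C, hC.le, fun x => ?_⟩
    have := hinf x
    rwa [le_div_iff₀ (by linarith [hE x])] at this

/-- The size of `‖χ_Q‖_{p(·)}` for a cube `Q ∋ x` of side length `r`. -/
noncomputable def tau {n : ℕ} (p : Rn n → ℝ) (pinf : ℝ) (x : Rn n) (r : ℝ) : ℝ :=
  (min r 1) ^ (n / p x) * (max r 1) ^ (n / pinf)

theorem tau_pos {n : ℕ} (p : Rn n → ℝ) (pinf : ℝ) (x : Rn n) {r : ℝ} (hr : 0 < r) :
    0 < tau p pinf x r := by
  have h1 : 0 < min r 1 := lt_min hr one_pos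
  have h2 : 0 < max r 1 := lt_max_of_lt_left hr
  unfold tau; positivity

theorem tau_of_le_one {n : ℕ} (p : Rn n → ℝ) (pinf : ℝ) (x : Rn n) {r : ℝ} (hr : r ≤ 1) :
    tau p pinf x r = r ^ (n / p x) := by
  simp [tau, hr]

theorem tau_of_one_le {n : ℕ} (p : Rn n → ℝ) (pinf : ℝ) (x : Rn n) {r : ℝ} (hr : 1 ≤ r) :
    tau p pinf x r = r ^ (n / pinf) := by
  simp [tau, hr]

theorem rpow_mul_tau_le {n : ℕ} {p : Rn n → ℝ} {pinf : ℝ} {x : Rn n} {r lam e : ℝ}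
    (hr : 0 < r) (hlam : 1 ≤ lam) (h1 : e ≤ n / p x) (h2 : e ≤ n / pinf) :
    lam ^ e * tau p pinf x r ≤ tau p pinf x (lam * r) := by
  have hr' : r ≤ lam * r := le_mul_of_one_le_left hr.le hlam
  have a1 : 0 < min r 1 := lt_min hr one_pos
  have a2 : 0 < max r 1 := lt_max_of_lt_left hr
  have b1 : min r 1 ≤ min (lam * r) 1 := min_le_min_right _ hr'
  have b2 : max r 1 ≤ max (lam * r) 1 := max_le_max_right _ hr'
  set μ := min (lam * r) 1 / min r 1 with hμ
  set ν := max (lam * r) 1 / max r 1 with hν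
  have hμ1 : 1 ≤ μ := (one_le_div a1).2 b1
  have hν1 : 1 ≤ ν := (one_le_div a2).2 b2
  have e1 : min (lam * r) 1 = μ * min r 1 := by rw [hμ]; field_simp
  have e2 : max (lam * r) 1 = ν * max r 1 := by rw [hν]; field_simp
  have hprod : μ * ν = lam := by
    have h3 : min (lam * r) 1 * max (lam * r) 1 = lam * r * 1 := min_mul_max _ _
    have h4 : min r 1 * max r 1 = r * 1 := min_mul_max _ _
    rw [hμ, hν, div_mul_div_comm, h3, h4]
    field_simp
  have hμ0 : 0 ≤ μ := by linarith
  have hν0 : 0 ≤ ν := by linarith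
  unfold tau
  rw [e1, e2, Real.mul_rpow hμ0 a1.le, Real.mul_rpow hν0 a2.le, ← hprod, Real.mul_rpow hμ0 hν0]
  have c1 : μ ^ e ≤ μ ^ (n / p x) := Real.rpow_le_rpow_of_exponent_le hμ1 h1
  have c2 : ν ^ e ≤ ν ^ (n / pinf) := Real.rpow_le_rpow_of_exponent_le hν1 h2
  calc _ = (μ ^ e * ν ^ e) * ((min r 1) ^ (n / p x) * (max r 1) ^ (n / pinf)) := by ring
    _ ≤ (μ ^ (n / p x) * ν ^ (n / pinf)) * ((min r 1) ^ (n / p x) * (max r 1) ^ (n / pinf)) := by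
        gcongr
    _ = _ := by ring

theorem setLIntegral_add_const_mul_le {n : ℕ} {A : Set (Rn n)} {F : Rn n → ℝ≥0∞}
    {g H : Rn n → ℝ≥0∞} {c : ℝ≥0∞} (hc : c ≠ ∞) (hA : MeasurableSet A) (hg : Measurable g)
    (hH : ∫⁻ y, H y ≤ 1) (h : ∀ y ∈ A, F y ≤ g y + c * H y) :
    ∫⁻ y in A, F y ≤ (∫⁻ y in A, g y) + c := by
  calc ∫⁻ y in A, F y ≤ ∫⁻ y in A, (g y + c * H y) := setLIntegral_mono' hA h
    _ = (∫⁻ y in A, g y) + c * ∫⁻ y in A, H y := by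
        rw [lintegral_add_left hg, lintegral_const_mul' _ _ hc]
    _ ≤ (∫⁻ y in A, g y) + c * 1 := by
        gcongr
        exact (setLIntegral_le_lintegral _ _).trans hH
    _ = _ := by rw [mul_one]

/-- Scale by scale comparison of exponents on a small cube. -/
theorem rpow_mul_div_le {a b d m D r : ℝ} (hr : 0 < r) (hr1 : r ≤ 1) (hm : 0 < m) (ha : m ≤ a)
    (hd : 0 ≤ d) (hab : |a - b| * (-Real.log r) ≤ D) :
    r ^ (d * b / a) ≤ r ^ d * Real.exp (d * D / m) := by
  have ha0 : 0 < a := by linarith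
  rw [Real.rpow_def_of_pos hr, Real.rpow_def_of_pos hr, ← Real.exp_add, Real.exp_le_exp]
  have hlr : 0 ≤ -Real.log r := by have := Real.log_nonpos hr.le hr1; linarith
  have h1 : Real.log r * (d * b / a) = Real.log r * d + d * ((a - b) * (-Real.log r)) / a := by
    field_simp; ring
  have h0 : (a - b) * (-Real.log r) ≤ |a - b| * (-Real.log r) :=
    mul_le_mul_of_nonneg_right (le_abs_self _) hlr
  have hD : 0 ≤ D := le_trans (by positivity) hab
  have h2 : d * ((a - b) * (-Real.log r)) / a ≤ d * D / a := by
    gcongr; linarith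
  have h3 : d * D / a ≤ d * D / m := by gcongr
  linarith

/-- Variable exponent Hölder inequality on cubes: the mean of `F` on a cube is at most
`C / ‖χ_Q‖_{P(·)}` whenever the modular of `F` is at most one. -/
theorem LogHolderExp.setLIntegral_cube_le {n : ℕ} {P : Rn n → ℝ} {Pinf : ℝ}
    (hP : LogHolderExp P Pinf) (h1 : ∀ x, 1 ≤ P x) (hinf1 : 1 ≤ Pinf) :
    ∃ C : ℝ, 0 < C ∧ ∀ F : Rn n → ℝ≥0∞, ∫⁻ y, F y ^ P y ≤ 1 → ∀ (x : Rn n) (r : ℝ), 0 < r →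
      ∫⁻ y in cube x (4 * r), F y ≤ ENNReal.ofReal (C * r ^ n / tau P Pinf x r) := by
  obtain ⟨D, hD0, hD⟩ := hP.loc
  obtain ⟨K, hK0, hK⟩ := hP.infty
  set E := Real.exp (n * D / 1) with hE
  set K' := Real.exp (K * (((n : ℝ) + 1) / 1)) with hK'
  have hWfin := lintegral_decayWeight_lt_top (n := n)
  set W := (∫⁻ y : Rn n, ENNReal.ofReal (decayWeight y)).toReal with hW
  have hW' : ∫⁻ y : Rn n, ENNReal.ofReal (decayWeight y) = ENNReal.ofReal W :=
    (ENNReal.ofReal_toReal hWfin.ne).symm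
  have hW0 : 0 ≤ W := ENNReal.toReal_nonneg
  have hE0 : 0 < E := Real.exp_pos _
  have hK'0 : 0 < K' := Real.exp_pos _
  refine ⟨4 ^ n + E + 1 + K' + W, by positivity, fun F hF x r hr => ?_⟩
  set T := tau P Pinf x r with hT
  have hTpos : 0 < T := tau_pos _ _ _ hr
  set t : ℝ≥0∞ := ENNReal.ofReal (1 / T) with ht
  have ht0 : t ≠ 0 := by rw [ht]; simpa using hTpos
  have httop : t ≠ ∞ := ENNReal.ofReal_ne_top
  have htpow : ∀ u : ℝ, t ^ (1 - u) = ENNReal.ofReal (T ^ u / T) := by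
    intro u
    rw [ht, ENNReal.ofReal_rpow_of_pos (by positivity), one_div, Real.inv_rpow hTpos.le,
      ← Real.rpow_neg hTpos.le, neg_sub, Real.rpow_sub hTpos, Real.rpow_one]
  have hvol : ∫⁻ _ in cube x (4 * r), t = ENNReal.ofReal (4 ^ n * (r ^ n / T)) := by
    rw [setLIntegral_const, volume_cube _ (by positivity), ht, ← ENNReal.ofReal_mul (by positivity)]
    congr 1
    rw [mul_pow]; ring
  have hA := measurableSet_cube x (4 * r)
  rcases le_total r 1 with hr1 | hr1
  · have hTr : T = r ^ (n / P x) := tau_of_le_one _ _ _ hr1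
    have hpt : ∀ y ∈ cube x (4 * r), F y ≤ t + ENNReal.ofReal (E * (r ^ n / T)) * F y ^ P y := by
      intro y hy
      refine (ennreal_le_add_rpow_mul (h1 y) ht0 httop).trans ?_
      rw [htpow, mul_comm]
      gcongr _ + ENNReal.ofReal ?_ * _
      rw [← mul_div_assoc]
      gcongr
      rw [hTr, ← Real.rpow_mul hr.le]
      have hn := norm_sub_le_of_mem_cube hy
      have hxy : ‖x - y‖ ≤ 2 * n * r := by
        rw [norm_sub_rev]; linarith
      have := rpow_mul_div_le (d := n) hr hr1 one_pos (h1 x) (by positivity)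
        (hD x y r hr hr1 hxy)
      rw [Real.rpow_natCast] at this
      calc _ = r ^ (n * P y / P x) := by congr 1; ring
        _ ≤ _ := by rw [mul_comm E]; exact this
    refine (setLIntegral_add_const_mul_le ENNReal.ofReal_ne_top hA measurable_const hF hpt).trans ?_
    rw [hvol, ← ENNReal.ofReal_add (by positivity) (by positivity)]
    apply ENNReal.ofReal_le_ofReal
    rw [mul_div_assoc]
    have : 0 ≤ r ^ n / T := by positivity
    nlinarith [mul_nonneg hK'0.le this, mul_nonneg hW0 this]
  · have hTr : T = r ^ (n / Pinf) := tau_of_one_le _ _ _ hr1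
    have hTn : T ^ Pinf = r ^ n := by
      rw [hTr, ← Real.rpow_mul hr.le, div_mul_cancel₀ _ (by linarith), Real.rpow_natCast]
    have hTle : 1 ≤ r ^ n / T := by
      rw [one_le_div hTpos, hTr, ← Real.rpow_natCast]
      apply Real.rpow_le_rpow_of_exponent_le hr1
      exact div_le_self (by positivity) hinf1
    set c0 : ℝ≥0∞ := ENNReal.ofReal (r ^ n / T) with hc0
    have hpt : ∀ y ∈ cube x (4 * r), F y ≤ (t + c0 * ENNReal.ofReal (decayWeight y)) +
        (1 + c0 * ENNReal.ofReal K') * F y ^ P y := by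
      intro y _
      rcases le_total 1 (F y) with hy | hy
      · calc F y = F y ^ (1 : ℝ) := by simp
          _ ≤ F y ^ P y := ENNReal.rpow_le_rpow_of_exponent_le hy (h1 y)
          _ ≤ (1 + c0 * ENNReal.ofReal K') * F y ^ P y := by
              conv_lhs => rw [← one_mul (F y ^ P y)]
              gcongr
              exact le_self_add
          _ ≤ _ := le_add_self
      · have hk := ennreal_rpow_le_mul_rpow_add (u := Pinf) (v := P y) (C := K) hy one_pos hinf1 y
          (by rw [abs_sub_comm]; exact hK y)
        calc F y ≤ t + F y ^ Pinf * t ^ (1 - Pinf) := ennreal_le_add_rpow_mul hinf1 ht0 httop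
          _ = t + c0 * F y ^ Pinf := by rw [htpow, hTn, mul_comm]
          _ ≤ t + c0 * (ENNReal.ofReal K' * F y ^ P y + ENNReal.ofReal (decayWeight y)) := by
              gcongr
          _ = (t + c0 * ENNReal.ofReal (decayWeight y)) + (c0 * ENNReal.ofReal K') * F y ^ P y := by
              ring
          _ ≤ _ := by gcongr; simp
    refine (setLIntegral_add_const_mul_le (by finiteness) hA
      (by have := measurable_decayWeight (n := n); fun_prop) hF hpt).trans ?_
    rw [lintegral_add_left measurable_const, hvol, lintegral_const_mul' _ _ ENNReal.ofReal_ne_top]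
    calc _ ≤ ENNReal.ofReal (4 ^ n * (r ^ n / T)) + c0 * ENNReal.ofReal W
          + (1 + c0 * ENNReal.ofReal K') := by
          gcongr
          rw [← hW']
          exact setLIntegral_le_lintegral _ _
      _ = ENNReal.ofReal (4 ^ n * (r ^ n / T) + r ^ n / T * W + (1 + r ^ n / T * K')) := by
          rw [hc0, ENNReal.ofReal_add (by positivity) (by positivity),
            ENNReal.ofReal_add (by positivity) (by positivity),
            ENNReal.ofReal_add (by positivity) (by positivity),
            ENNReal.ofReal_mul (p := r ^ n / T) (by positivity),
            ENNReal.ofReal_mul (p := r ^ n / T) (by positivity), ENNReal.ofReal_one]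
      _ ≤ _ := by
          apply ENNReal.ofReal_le_ofReal
          rw [mul_div_assoc]
          have : 0 ≤ E * (r ^ n / T) := by positivity
          nlinarith

theorem tsum_indicator_scale_le {n : ℕ} {b : ℕ → ℝ≥0∞} {z : ℕ → Rn n} {ρ : ℕ → ℝ} {x : Rn n}
    {r : ℝ} (hr : 0 < r) {V : ℝ}
    (hV : ∫⁻ y in cube x (4 * r), ∑' j, b j * cubeInd (z j) (ρ j) y ≤
      ENNReal.ofReal (V * r ^ n)) :
    ∑' j, {j | x ∈ cube (z j) (ρ j) ∧ r ≤ ρ j ∧ ρ j ≤ 2 * r}.indicator b j ≤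
      ENNReal.ofReal V := by
  set S := {j | x ∈ cube (z j) (ρ j) ∧ r ≤ ρ j ∧ ρ j ≤ 2 * r} with hS
  have hrn : 0 < r ^ n := by positivity
  have h1 : ENNReal.ofReal (r ^ n) * ∑' j, S.indicator b j ≤ ENNReal.ofReal (V * r ^ n) := by
    calc ENNReal.ofReal (r ^ n) * ∑' j, S.indicator b j
        = ∑' j, ENNReal.ofReal (r ^ n) * S.indicator b j := ENNReal.tsum_mul_left.symm
      _ ≤ ∑' j, ∫⁻ y, S.indicator b j * cubeInd (z j) (ρ j) y := by
          refine ENNReal.tsum_le_tsum fun j => ?_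
          by_cases hj : j ∈ S
          · have hρ : 0 ≤ ρ j := hr.le.trans hj.2.1
            rw [lintegral_const_mul _ (measurable_cubeInd _ _), lintegral_cubeInd _ hρ, mul_comm]
            gcongr
            exact hj.2.1
          · simp [hj]
      _ = ∫⁻ y, ∑' j, S.indicator b j * cubeInd (z j) (ρ j) y := by
          rw [lintegral_tsum]
          exact fun j => ((measurable_cubeInd _ _).const_mul _).aemeasurable
      _ ≤ ∫⁻ y in cube x (4 * r), ∑' j, b j * cubeInd (z j) (ρ j) y := by
          rw [← lintegral_indicator (measurableSet_cube _ _)]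
          refine lintegral_mono fun y => ?_
          by_cases hy : y ∈ cube x (4 * r)
          · rw [Set.indicator_of_mem hy]
            exact ENNReal.tsum_le_tsum fun j =>
              mul_le_mul_left (Set.indicator_le_self _ _ _) _
          · rw [Set.indicator_of_notMem hy]
            refine le_of_eq (ENNReal.tsum_eq_zero.2 fun j => ?_)
            by_cases hj : j ∈ S
            · have : y ∉ cube (z j) (ρ j) := by
                intro hyj
                refine hy fun i => ?_
                have h2 := hyj i
                have h3 := hj.1 i
                rw [abs_le] at h2 h3 ⊢
                have h4 := hj.2.2
                constructor <;> linarith [h2.1, h2.2, h3.1, h3.2]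
              rw [cubeInd_of_notMem this, mul_zero]
            · simp [hj]
      _ ≤ _ := hV
  rw [mul_comm V, ENNReal.ofReal_mul hrn.le] at h1
  exact (ENNReal.mul_le_mul_iff_right (by simpa using hrn) ENNReal.ofReal_ne_top).1 h1

theorem exists_dyadic_scale {R ρ : ℝ} (hR : 0 < R) (h : R ≤ ρ) :
    ∃ i : ℕ, 2 ^ i * R ≤ ρ ∧ ρ ≤ 2 * (2 ^ i * R) := by
  obtain ⟨i, h1, h2⟩ := exists_nat_pow_near ((one_le_div hR).2 h) (one_lt_two (α := ℝ))
  refine ⟨i, (le_div_iff₀ hR).1 h1, ?_⟩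
  have := (div_lt_iff₀ hR).1 h2
  rw [pow_succ] at this
  linarith

/-- Pointwise bound of Hedberg type, with a free splitting radius `R`. -/
theorem tsum_mul_rpow_le_hedberg {n : ℕ} {P : Rn n → ℝ} {Pinf a M C : ℝ} (ha : 0 ≤ a)
    (haM : a < n / M) (hPM : ∀ x, 0 < P x ∧ P x ≤ M) (hinfM : 0 < Pinf ∧ Pinf ≤ M)
    (hC : 0 < C) {b : ℕ → ℝ≥0∞} {z : ℕ → Rn n} {ρ : ℕ → ℝ} (hρ : ∀ j, 0 < ρ j)
    (hF : ∀ (x : Rn n) (r : ℝ), 0 < r →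
      ∫⁻ y in cube x (4 * r), ∑' j, b j * cubeInd (z j) (ρ j) y ≤
        ENNReal.ofReal (C * r ^ n / tau P Pinf x r))
    (x : Rn n) {R : ℝ} (hR : 0 < R) :
    ∑' j, b j * ENNReal.ofReal (ρ j ^ a) * cubeInd (z j) (ρ j) x ≤
      ENNReal.ofReal (R ^ a) * (∑' j, b j * cubeInd (z j) (ρ j) x +
        ENNReal.ofReal (C * 2 ^ a * (1 - 2 ^ (a - n / M))⁻¹ / tau P Pinf x R)) := by
  set S : ℕ → Set ℕ := fun i =>
    {j | x ∈ cube (z j) (ρ j) ∧ 2 ^ i * R ≤ ρ j ∧ ρ j ≤ 2 * (2 ^ i * R)} with hS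
  set T := tau P Pinf x R with hT
  have hT0 : 0 < T := tau_pos _ _ _ hR
  set θ : ℝ := 2 ^ (a - n / M) with hθ
  have hθ0 : 0 < θ := by positivity
  have hθ1 : θ < 1 := Real.rpow_lt_one_of_one_lt_of_neg one_lt_two (by linarith)
  have hterm : ∀ j, b j * ENNReal.ofReal (ρ j ^ a) * cubeInd (z j) (ρ j) x ≤
      ENNReal.ofReal (R ^ a) * (b j * cubeInd (z j) (ρ j) x) +
        ∑' i, ENNReal.ofReal ((2 * (2 ^ i * R)) ^ a) * (S i).indicator b j := by
    intro j
    by_cases hx : x ∈ cube (z j) (ρ j)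
    · rw [cubeInd_of_mem hx, mul_one, mul_one]
      rcases le_total (ρ j) R with h | h
      · refine le_trans ?_ le_self_add
        rw [mul_comm]
        have := (hρ j).le
        gcongr
      · refine le_trans ?_ le_add_self
        obtain ⟨i, hi1, hi2⟩ := exists_dyadic_scale hR h
        refine le_trans ?_ (ENNReal.le_tsum i)
        have hj : j ∈ S i := ⟨hx, hi1, hi2⟩
        rw [Set.indicator_of_mem hj, mul_comm]
        have := (hρ j).le
        gcongr
    · simp [cubeInd_of_notMem hx]
  have hscale : ∀ i : ℕ, ∑' j, ENNReal.ofReal ((2 * (2 ^ i * R)) ^ a) * (S i).indicator b j ≤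
      ENNReal.ofReal (R ^ a * (C * 2 ^ a / T) * θ ^ i) := by
    intro i
    have hri : 0 < 2 ^ i * R := by positivity
    set Ti := tau P Pinf x (2 ^ i * R) with hTi
    have hTi0 : 0 < Ti := tau_pos _ _ _ hri
    have h1 : ∑' j, (S i).indicator b j ≤ ENNReal.ofReal (C / Ti) := by
      refine tsum_indicator_scale_le hri ?_
      rw [div_mul_eq_mul_div]
      exact hF x _ hri
    have h2 : ((2 : ℝ) ^ i) ^ (n / M) * T ≤ Ti := by
      apply rpow_mul_tau_le hR (one_le_pow₀ one_le_two)
      · exact div_le_div_of_nonneg_left (by positivity) (hPM x).1 (hPM x).2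
      · exact div_le_div_of_nonneg_left (by positivity) hinfM.1 hinfM.2
    rw [ENNReal.tsum_mul_left]
    calc _ ≤ ENNReal.ofReal ((2 * (2 ^ i * R)) ^ a) * ENNReal.ofReal (C / Ti) := by gcongr
      _ = ENNReal.ofReal ((2 * (2 ^ i * R)) ^ a * (C / Ti)) :=
          (ENNReal.ofReal_mul (by positivity)).symm
      _ ≤ _ := by
          apply ENNReal.ofReal_le_ofReal
          have h3 : C / Ti ≤ C / (((2 : ℝ) ^ i) ^ (n / M) * T) := by gcongr
          calc _ ≤ (2 * (2 ^ i * R)) ^ a * (C / (((2 : ℝ) ^ i) ^ (n / M) * T)) := by gcongr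
            _ = R ^ a * (C * 2 ^ a / T) * (((2 : ℝ) ^ i) ^ a / ((2 : ℝ) ^ i) ^ (n / M)) := by
                rw [Real.mul_rpow (by norm_num) hri.le, Real.mul_rpow (by positivity) hR.le]
                field_simp
            _ = R ^ a * (C * 2 ^ a / T) * θ ^ i := by
                rw [← Real.rpow_sub (by positivity), hθ, ← Real.rpow_natCast, ← Real.rpow_mul
                  (by norm_num), ← Real.rpow_natCast, ← Real.rpow_mul (by norm_num), mul_comm (i : ℝ)]
            _ ≤ _ := le_rfl
  have hgeom : ∑' i : ℕ, ENNReal.ofReal (R ^ a * (C * 2 ^ a / T) * θ ^ i) =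
      ENNReal.ofReal (R ^ a) * ENNReal.ofReal (C * 2 ^ a * (1 - θ)⁻¹ / T) := by
    rw [← ENNReal.ofReal_tsum_of_nonneg (fun i => by positivity)
      ((summable_geometric_of_lt_one hθ0.le hθ1).mul_left _), tsum_mul_left,
      tsum_geometric_of_lt_one hθ0.le hθ1, ← ENNReal.ofReal_mul (by positivity)]
    congr 1
    ring
  calc _ ≤ ∑' j, (ENNReal.ofReal (R ^ a) * (b j * cubeInd (z j) (ρ j) x) +
        ∑' i, ENNReal.ofReal ((2 * (2 ^ i * R)) ^ a) * (S i).indicator b j) :=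
        ENNReal.tsum_le_tsum hterm
    _ = ENNReal.ofReal (R ^ a) * ∑' j, b j * cubeInd (z j) (ρ j) x +
        ∑' i, ∑' j, ENNReal.ofReal ((2 * (2 ^ i * R)) ^ a) * (S i).indicator b j := by
        rw [ENNReal.tsum_add, ENNReal.tsum_mul_left, ENNReal.tsum_comm]
    _ ≤ ENNReal.ofReal (R ^ a) * ∑' j, b j * cubeInd (z j) (ρ j) x +
        ∑' i, ENNReal.ofReal (R ^ a * (C * 2 ^ a / T) * θ ^ i) := by
        gcongr with i; exact hscale i
    _ = _ := by rw [hgeom, mul_add]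

theorem hedberg_optimal_radius {f a c d C T : ℝ} (hf : 0 < f) (hC : 0 < C) (hT : T = f⁻¹) :
    ENNReal.ofReal ((f ^ (-(c / d))) ^ a) * (ENNReal.ofReal f + ENNReal.ofReal (C / T)) =
      ENNReal.ofReal ((1 + C) * f ^ (1 - a * c / d)) := by
  rw [hT, ← ENNReal.ofReal_add hf.le (by positivity), ← ENNReal.ofReal_mul (by positivity),
    ← Real.rpow_mul hf.le, Real.rpow_sub hf, Real.rpow_one]
  congr 1
  rw [show -(c / d) * a = -(a * c / d) by ring, Real.rpow_neg hf.le, div_inv_eq_mul]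
  field_simp

/-- Boundedness of the fractional averaging of cubes, in modular form. -/
theorem LogHolderExp.exists_lintegral_fractional_le {n : ℕ} (hn : 0 < n) {P Q : Rn n → ℝ}
    {Pinf a M : ℝ} (hP : LogHolderExp P Pinf) (h1 : ∀ x, 1 ≤ P x ∧ P x ≤ M)
    (hinf1 : 1 ≤ Pinf ∧ Pinf ≤ M) (ha : 0 ≤ a) (haM : a * M < n)
    (hQ : ∀ x, 1 / Q x = 1 / P x - a / n) :
    ∃ C : ℝ, 0 < C ∧ ∀ (b : ℕ → ℝ≥0∞) (z : ℕ → Rn n) (ρ : ℕ → ℝ), (∀ j, 0 < ρ j) →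
      ∫⁻ x, (∑' j, b j * cubeInd (z j) (ρ j) x) ^ P x ≤ 1 →
      ∫⁻ x, (∑' j, b j * ENNReal.ofReal (ρ j ^ a) * cubeInd (z j) (ρ j) x) ^ Q x ≤
        ENNReal.ofReal C := by
  have hn' : (0 : ℝ) < n := by exact_mod_cast hn
  have hM : 0 < M := by linarith [hinf1.1, hinf1.2]
  obtain ⟨C, hC, hF⟩ := hP.setLIntegral_cube_le (fun x => (h1 x).1) hinf1.1
  obtain ⟨K, hK0, hK⟩ := hP.infty
  have haM' : a < n / M := by rwa [lt_div_iff₀ hM]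
  set θ : ℝ := 2 ^ (a - n / M) with hθ
  have hθ1 : θ < 1 := Real.rpow_lt_one_of_one_lt_of_neg one_lt_two (by linarith)
  set C2 := C * 2 ^ a * (1 - θ)⁻¹ with hC2
  have hC20 : 0 < C2 := by
    have : 0 < 1 - θ := by linarith
    positivity
  set δ := 1 - a * M / n with hδ
  have hδ0 : 0 < δ := by
    have : a * M / n < 1 := by rwa [div_lt_one hn']
    linarith
  have hδle : ∀ c, c ≤ M → δ ≤ 1 - a * c / n := by
    intro c hc
    have : a * c / n ≤ a * M / n := by gcongr
    linarith
  have hQeq : ∀ x, Q x = P x / (1 - a * P x / n) := by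
    intro x
    have hp : 0 < P x := by linarith [(h1 x).1]
    have h2 : 1 / Q x = (1 - a * P x / n) / P x := by
      rw [hQ x]; field_simp
    have h3 := hδle _ (h1 x).2
    rw [← one_div_one_div (Q x), h2, one_div_div]
  have hQ1 : ∀ x, 1 ≤ Q x := by
    intro x
    rw [hQeq x, one_le_div (by linarith [hδle _ (h1 x).2])]
    have : 0 ≤ a * P x / n := by have := (h1 x).1; positivity
    linarith [(h1 x).1]
  have hQM : ∀ x, Q x ≤ M / δ := by
    intro x
    rw [hQeq x]
    exact div_le_div₀ hM.le (h1 x).2 hδ0 (hδle _ (h1 x).2)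
  set L := M / δ * (a / n) * K with hL
  have hL0 : 0 ≤ L := by positivity
  set A := (1 + C2) ^ (M / δ) with hA
  have hA0 : 0 < A := by positivity
  set B := Real.exp (L * (((n : ℝ) + 1) / δ)) with hB
  have hB1 : 1 ≤ B := Real.one_le_exp (by positivity)
  have hWfin := lintegral_decayWeight_lt_top (n := n)
  set W := (∫⁻ y : Rn n, ENNReal.ofReal (decayWeight y)).toReal with hW
  have hW' : ∫⁻ y : Rn n, ENNReal.ofReal (decayWeight y) = ENNReal.ofReal W :=
    (ENNReal.ofReal_toReal hWfin.ne).symm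
  have hW0 : 0 ≤ W := ENNReal.toReal_nonneg
  refine ⟨A * (W + B), by positivity, fun b z ρ hρ hmod => ?_⟩
  set F : Rn n → ℝ≥0∞ := fun x => ∑' j, b j * cubeInd (z j) (ρ j) x with hFdef
  set G : Rn n → ℝ≥0∞ := fun x =>
    ∑' j, b j * ENNReal.ofReal (ρ j ^ a) * cubeInd (z j) (ρ j) x with hGdef
  have hed : ∀ (x : Rn n) {R : ℝ}, 0 < R → G x ≤ ENNReal.ofReal (R ^ a) * (F x +
      ENNReal.ofReal (C2 / tau P Pinf x R)) := fun x R hR =>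
    tsum_mul_rpow_le_hedberg ha haM' (fun x => ⟨by linarith [(h1 x).1], (h1 x).2⟩)
      ⟨by linarith [hinf1.1], hinf1.2⟩ hC hρ (fun x r hr => hF F hmod x r hr) x hR
  have hpowC : ∀ x, (1 + C2) ^ Q x ≤ A := fun x =>
    Real.rpow_le_rpow_of_exponent_le (by linarith) (hQM x)
  have hfin : ∀ (x : Rn n) (f c : ℝ), 0 < f → G x ≤ ENNReal.ofReal ((1 + C2) * f ^ c) →
      G x ^ Q x ≤ ENNReal.ofReal A * ENNReal.ofReal f ^ (c * Q x) := by
    intro x f c hf h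
    have hq : 0 ≤ Q x := by linarith [hQ1 x]
    calc G x ^ Q x ≤ ENNReal.ofReal ((1 + C2) * f ^ c) ^ Q x := ENNReal.rpow_le_rpow h hq
      _ = ENNReal.ofReal ((1 + C2) ^ Q x) * ENNReal.ofReal f ^ (c * Q x) := by
          rw [ENNReal.ofReal_rpow_of_pos (by positivity), Real.mul_rpow (by positivity)
            (by positivity), ENNReal.ofReal_mul (by positivity), ← Real.rpow_mul hf.le,
            ENNReal.ofReal_rpow_of_pos hf]
      _ ≤ _ := by gcongr; exact hpowC x
  have hpt : ∀ x, G x ^ Q x ≤ ENNReal.ofReal A *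
      (ENNReal.ofReal (decayWeight x) + ENNReal.ofReal B * F x ^ P x) := by
    intro x
    have hp : 0 < P x := by linarith [(h1 x).1]
    have hq : 0 < Q x := by linarith [hQ1 x]
    have hBle : F x ^ P x ≤ ENNReal.ofReal (decayWeight x) + ENNReal.ofReal B * F x ^ P x := by
      refine le_trans ?_ le_add_self
      conv_lhs => rw [← one_mul (F x ^ P x)]
      gcongr
      simpa using hB1
    rcases eq_or_ne (F x) 0 with h0 | h0
    · have : G x = 0 := by
        refine ENNReal.tsum_eq_zero.2 fun j => ?_
        have := ENNReal.tsum_eq_zero.1 h0 j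
        rw [mul_right_comm, this, zero_mul]
      rw [this, ENNReal.zero_rpow_of_pos hq]
      exact zero_le
    rcases eq_or_ne (F x) ∞ with ht | ht
    · have : F x ^ P x = ∞ := by rw [ht, ENNReal.top_rpow_of_pos hp]
      rw [this] at hBle
      rw [this, top_le_iff.1 hBle, ENNReal.mul_top (by simpa using hA0)]
      exact le_top
    obtain ⟨f, hf, hFf⟩ : ∃ f : ℝ, 0 < f ∧ F x = ENNReal.ofReal f :=
      ⟨(F x).toReal, ENNReal.toReal_pos h0 ht, (ENNReal.ofReal_toReal ht).symm⟩
    rcases le_total 1 f with hf1 | hf1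
    · have hR1 : f ^ (-(P x / n)) ≤ 1 :=
        Real.rpow_le_one_of_one_le_of_nonpos hf1 (by have : 0 < P x / n := by positivity
                                                     linarith)
      have hT : tau P Pinf x (f ^ (-(P x / n))) = f⁻¹ := by
        rw [tau_of_le_one _ _ _ hR1, ← Real.rpow_mul hf.le, ← Real.rpow_neg_one]
        congr 1
        field_simp
      have hG := hed x (R := f ^ (-(P x / n))) (by positivity)
      rw [hFf, hedberg_optimal_radius hf hC20 hT] at hG
      have h3 := hfin x f _ hf hG
      rw [show (1 - a * P x / n) * Q x = P x by
        rw [hQeq x]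
        have := hδle _ (h1 x).2
        exact mul_div_cancel₀ _ (by linarith), ← hFf] at h3
      exact h3.trans (by gcongr)
    · have hpi : 0 < Pinf := by linarith [hinf1.1]
      have hR1 : 1 ≤ f ^ (-(Pinf / n)) :=
        Real.one_le_rpow_of_pos_of_le_one_of_nonpos hf hf1 (by have : 0 < Pinf / n := by positivity
                                                               linarith)
      have hT : tau P Pinf x (f ^ (-(Pinf / n))) = f⁻¹ := by
        rw [tau_of_one_le _ _ _ hR1, ← Real.rpow_mul hf.le, ← Real.rpow_neg_one]
        congr 1
        field_simp
      have hG := hed x (R := f ^ (-(Pinf / n))) (by positivity)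
      rw [hFf, hedberg_optimal_radius hf hC20 hT] at hG
      have h3 := hfin x f _ hf hG
      refine h3.trans ?_
      rw [hFf]
      gcongr
      rw [add_comm]
      apply ennreal_rpow_le_mul_rpow_add (by simpa using hf1) hδ0
      · have h4 := hδle _ hinf1.2
        calc δ = δ * 1 := by ring
          _ ≤ _ := mul_le_mul h4 (hQ1 x) zero_le_one (by linarith)
      · have h4 := hδle _ (h1 x).2
        have h5 : (1 - a * Pinf / n) * Q x - P x = Q x * (a / n) * (P x - Pinf) := by
          have : P x = (1 - a * P x / n) * Q x := by
            rw [hQeq x]; exact (mul_div_cancel₀ _ (by linarith)).symm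
          nth_rewrite 1 [this]
          ring
        rw [h5, abs_mul, abs_of_nonneg (by positivity)]
        calc _ = (Q x * (a / n)) * (|P x - Pinf| * Real.log (Real.exp 1 + ‖x‖)) := by ring
          _ ≤ (M / δ * (a / n)) * K :=
            mul_le_mul (by gcongr; exact hQM x) (hK x)
              (mul_nonneg (abs_nonneg _) (Real.log_nonneg (by
                have := Real.one_le_exp (x := 1) zero_le_one
                have := norm_nonneg x
                linarith))) (by positivity)
  calc ∫⁻ x, G x ^ Q x ≤ ∫⁻ x, ENNReal.ofReal A *
        (ENNReal.ofReal (decayWeight x) + ENNReal.ofReal B * F x ^ P x) := lintegral_mono hpt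
    _ = ENNReal.ofReal A * (ENNReal.ofReal W + ENNReal.ofReal B * ∫⁻ x, F x ^ P x) := by
        rw [lintegral_const_mul' _ _ ENNReal.ofReal_ne_top, lintegral_add_left
          measurable_decayWeight.ennreal_ofReal, lintegral_const_mul' _ _ ENNReal.ofReal_ne_top, hW']
    _ ≤ ENNReal.ofReal A * (ENNReal.ofReal W + ENNReal.ofReal B * 1) := by gcongr
    _ = _ := by
        rw [mul_one, ← ENNReal.ofReal_add hW0 (by linarith), ← ENNReal.ofReal_mul hA0.le]

theorem tau_div_const {n : ℕ} (p : Rn n → ℝ) (pinf : ℝ) (x : Rn n) {r s : ℝ} (hr : 0 < r) :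
    tau (fun y => p y / s) (pinf / s) x r = tau p pinf x r ^ s := by
  have a1 : 0 < min r 1 := lt_min hr one_pos
  have a2 : 0 < max r 1 := lt_max_of_lt_left hr
  unfold tau
  rw [Real.mul_rpow (by positivity) (by positivity), ← Real.rpow_mul a1.le, ← Real.rpow_mul a2.le,
    div_div_eq_mul_div, div_div_eq_mul_div, div_mul_eq_mul_div, div_mul_eq_mul_div]

theorem tau_eq_div_rpow {n : ℕ} (hn : 0 < n) {p q : Rn n → ℝ} {pinf qinf α : ℝ} {x : Rn n}
    (hx : 1 / q x = 1 / p x - α / n) (hinf : 1 / qinf = 1 / pinf - α / n) {r : ℝ} (hr : 0 < r) :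
    tau q qinf x r = tau p pinf x r / r ^ α := by
  have hn' : (n : ℝ) ≠ 0 := by positivity
  have a1 : 0 < min r 1 := lt_min hr one_pos
  have a2 : 0 < max r 1 := lt_max_of_lt_left hr
  have e1 : (n : ℝ) / q x = n / p x - α := by
    rw [← mul_one_div, hx, mul_sub, mul_one_div, mul_div_cancel₀ _ hn']
  have e2 : (n : ℝ) / qinf = n / pinf - α := by
    rw [← mul_one_div, hinf, mul_sub, mul_one_div, mul_div_cancel₀ _ hn']
  have e3 : r = min r 1 * max r 1 := by rw [min_mul_max, mul_one]
  have e4 : r ^ α = min r 1 ^ α * max r 1 ^ α := by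
    rw [← Real.mul_rpow a1.le a2.le, ← e3]
  unfold tau
  rw [e1, e2, e4, Real.rpow_sub a1, Real.rpow_sub a2, div_mul_div_comm]

theorem LogHolderExp.div_const {n : ℕ} {p : Rn n → ℝ} {pinf s : ℝ} (hp : LogHolderExp p pinf)
    (hs : 0 < s) : LogHolderExp (fun x => p x / s) (pinf / s) := by
  obtain ⟨m, M, hm, hb, h1, h2⟩ := hp.bounds
  refine hp.of_lipschitz (hp.measurable.div_const s)
    ⟨m / s, M / s, by positivity, fun x => ⟨?_, ?_⟩, ?_, ?_⟩ (K := 1 / s) (by positivity) ?_ ?_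
  · exact div_le_div_of_nonneg_right (hb x).1 hs.le
  · exact div_le_div_of_nonneg_right (hb x).2 hs.le
  · exact div_le_div_of_nonneg_right h1 hs.le
  · exact div_le_div_of_nonneg_right h2 hs.le
  · intro x y
    rw [← sub_div, abs_div, abs_of_pos hs, one_div_mul_eq_div]
  · intro x
    rw [← sub_div, abs_div, abs_of_pos hs, one_div_mul_eq_div]

theorem varLpNorm_le_of_modular_le {n : ℕ} {p : Rn n → ℝ} {f : Rn n → ℝ≥0∞} {m V : ℝ}
    {l : ℝ≥0∞} (hm : 0 < m) (hp : ∀ x, m ≤ p x) (hV : 1 ≤ V) (hl : l ≠ 0) (hl' : l ≠ ∞)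
    (h : ∫⁻ x, (f x / l) ^ p x ≤ ENNReal.ofReal V) :
    varLpNorm p f ≤ ENNReal.ofReal (V ^ (1 / m)) * l := by
  have hV0 : 0 < V := by linarith
  set c := V ^ (1 / m) with hc
  have hc1 : 1 ≤ c := Real.one_le_rpow hV (by positivity)
  have hc0 : 0 < c := by linarith
  have hcE : ENNReal.ofReal c ≠ 0 := by simpa using hc0
  refine sInf_le ⟨ENNReal.mul_pos hcE hl, ENNReal.mul_lt_top ENNReal.ofReal_lt_top hl'.lt_top, ?_⟩
  have hpt : ∀ x, (f x / (ENNReal.ofReal c * l)) ^ p x ≤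
      ENNReal.ofReal V⁻¹ * (f x / l) ^ p x := by
    intro x
    have hpx : 0 ≤ p x := by linarith [hp x]
    rw [div_eq_mul_inv, ENNReal.mul_inv (Or.inl hcE) (Or.inl ENNReal.ofReal_ne_top),
      mul_left_comm, ← div_eq_mul_inv, ENNReal.mul_rpow_of_nonneg _ _ hpx]
    gcongr
    rw [← ENNReal.ofReal_inv_of_pos hc0, ENNReal.ofReal_rpow_of_pos (by positivity)]
    apply ENNReal.ofReal_le_ofReal
    rw [Real.inv_rpow hc0.le]
    apply inv_anti₀ hV0
    calc V = c ^ m := by rw [hc, ← Real.rpow_mul hV0.le, one_div_mul_cancel hm.ne', Real.rpow_one]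
      _ ≤ c ^ p x := Real.rpow_le_rpow_of_exponent_le hc1 (hp x)
  calc _ ≤ ∫⁻ x, ENNReal.ofReal V⁻¹ * (f x / l) ^ p x := lintegral_mono hpt
    _ = ENNReal.ofReal V⁻¹ * ∫⁻ x, (f x / l) ^ p x :=
        lintegral_const_mul' _ _ ENNReal.ofReal_ne_top
    _ ≤ ENNReal.ofReal V⁻¹ * ENNReal.ofReal V := by gcongr
    _ = 1 := by
        rw [← ENNReal.ofReal_mul (by positivity), inv_mul_cancel₀ hV0.ne', ENNReal.ofReal_one]

theorem LogHolderExp.exists_varLpNorm_cubeInd_le {n : ℕ} {p : Rn n → ℝ} {pinf : ℝ}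
    (hp : LogHolderExp p pinf) :
    ∃ C : ℝ, 0 < C ∧ ∀ (z : Rn n) (r : ℝ), 0 < r →
      varLpNorm p (cubeInd z r) ≤ ENNReal.ofReal (C * tau p pinf z r) := by
  obtain ⟨D, hD0, hD⟩ := hp.loc
  obtain ⟨K, hK0, hK⟩ := hp.infty
  obtain ⟨m, M, hm, hb, hinfm, hinfM⟩ := hp.bounds
  set E := Real.exp (n * D / m) with hE
  set K' := Real.exp (K * (((n : ℝ) + 1) / m)) with hK'
  have hWfin := lintegral_decayWeight_lt_top (n := n)
  set W := (∫⁻ y : Rn n, ENNReal.ofReal (decayWeight y)).toReal with hW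
  have hW' : ∫⁻ y : Rn n, ENNReal.ofReal (decayWeight y) = ENNReal.ofReal W :=
    (ENNReal.ofReal_toReal hWfin.ne).symm
  have hW0 : 0 ≤ W := ENNReal.toReal_nonneg
  have hE0 : 1 ≤ E := Real.one_le_exp (by positivity)
  have hK'0 : 0 < K' := Real.exp_pos _
  refine ⟨(E + K' + W) ^ (1 / m), by positivity, fun z r hr => ?_⟩
  set T := tau p pinf z r with hT
  have hT0 : 0 < T := tau_pos _ _ _ hr
  rw [ENNReal.ofReal_mul (by positivity)]
  refine varLpNorm_le_of_modular_le hm (fun x => (hb x).1) (by linarith) (by simpa using hT0)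
    ENNReal.ofReal_ne_top ?_
  have hrn : 0 < r ^ n := by positivity
  have hind : ∀ y, (cubeInd z r y / ENNReal.ofReal T) ^ p y =
      (cube z r).indicator (fun y => ENNReal.ofReal T⁻¹ ^ p y) y := by
    intro y
    by_cases hy : y ∈ cube z r
    · rw [cubeInd_of_mem hy, Set.indicator_of_mem hy, one_div, ENNReal.ofReal_inv_of_pos hT0]
    · rw [cubeInd_of_notMem hy, Set.indicator_of_notMem hy, ENNReal.zero_div,
        ENNReal.zero_rpow_of_pos (by linarith [(hb y).1])]
  have hconst : ∀ c : ℝ, 0 ≤ c → ∫⁻ _ in cube z r, ENNReal.ofReal (c / r ^ n) =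
      ENNReal.ofReal c := by
    intro c hc
    rw [setLIntegral_const, volume_cube _ hr.le, ← ENNReal.ofReal_mul (by positivity),
      div_mul_cancel₀ _ hrn.ne']
  rw [lintegral_congr hind, lintegral_indicator (measurableSet_cube _ _)]
  rcases le_total r 1 with hr1 | hr1
  · have hTr : T = r ^ (n / p z) := tau_of_le_one _ _ _ hr1
    calc _ ≤ ∫⁻ _ in cube z r, ENNReal.ofReal (E / r ^ n) := by
          refine setLIntegral_mono' (measurableSet_cube _ _) fun y hy => ?_
          rw [ENNReal.ofReal_rpow_of_pos (by positivity)]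
          apply ENNReal.ofReal_le_ofReal
          have hpz : 0 < p z := by linarith [(hb z).1]
          have hxy : ‖z - y‖ ≤ 2 * n * r := by
            have := norm_sub_le_of_mem_cube hy
            rw [norm_sub_rev]
            have h0 : 0 ≤ n * r := by positivity
            linarith
          have h := rpow_mul_div_le (d := n) (b := 2 * p z - p y) (D := D) hr hr1 hm (hb z).1
            (by positivity) (by
              rw [show p z - (2 * p z - p y) = -(p z - p y) by ring, abs_neg]
              exact hD z y r hr hr1 hxy)
          rw [show n * (2 * p z - p y) / p z = n + n - n / p z * p y by field_simp; ring,
            Real.rpow_sub hr, Real.rpow_add hr, Real.rpow_mul hr.le, ← hTr,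
            Real.rpow_natCast] at h
          rw [Real.inv_rpow hT0.le, le_div_iff₀ hrn]
          have h2 : r ^ n * r ^ n / T ^ p y = r ^ n * ((T ^ p y)⁻¹ * r ^ n) := by
            rw [div_eq_mul_inv]; ring
          rw [h2] at h
          exact le_of_mul_le_mul_left h hrn
      _ = ENNReal.ofReal E := hconst E (by linarith)
      _ ≤ _ := ENNReal.ofReal_le_ofReal (by linarith)
  · have hTr : T = r ^ (n / pinf) := tau_of_one_le _ _ _ hr1
    have hpi : 0 < pinf := by linarith
    have hTn : ENNReal.ofReal T⁻¹ ^ pinf = ENNReal.ofReal (r ^ n)⁻¹ := by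
      rw [ENNReal.ofReal_rpow_of_pos (by positivity), Real.inv_rpow hT0.le, hTr,
        ← Real.rpow_mul hr.le, div_mul_cancel₀ _ hpi.ne', Real.rpow_natCast]
    have hT1 : T⁻¹ ≤ 1 := by
      apply inv_le_one_of_one_le₀
      rw [hTr]
      exact Real.one_le_rpow hr1 (by positivity)
    calc _ ≤ ∫⁻ y in cube z r, (ENNReal.ofReal (K' / r ^ n) +
            ENNReal.ofReal (decayWeight y)) := by
          refine lintegral_mono fun y => ?_
          have := ennreal_rpow_le_mul_rpow_add (a := ENNReal.ofReal T⁻¹) (by simpa using hT1) hm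
            (hb y).1 y (hK y)
          rwa [hTn, ← ENNReal.ofReal_mul hK'0.le, ← div_eq_mul_inv] at this
      _ = ENNReal.ofReal K' + ∫⁻ y in cube z r, ENNReal.ofReal (decayWeight y) := by
          rw [lintegral_add_left measurable_const, hconst _ hK'0.le]
      _ ≤ ENNReal.ofReal K' + ENNReal.ofReal W := by
          gcongr
          rw [← hW']
          exact setLIntegral_le_lintegral _ _
      _ = ENNReal.ofReal (K' + W) := (ENNReal.ofReal_add hK'0.le hW0).symm
      _ ≤ _ := ENNReal.ofReal_le_ofReal (by linarith)

theorem LogHolderExp.exists_le_varLpNorm_cubeInd {n : ℕ} {q : Rn n → ℝ} {qinf : ℝ}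
    (hq : LogHolderExp q qinf) :
    ∃ C : ℝ, 0 < C ∧ ∀ (z : Rn n) (r : ℝ), 0 < r →
      ENNReal.ofReal (tau q qinf z r) ≤ ENNReal.ofReal C * varLpNorm q (cubeInd z r) := by
  obtain ⟨s, M, hs, hb, hinfm, hinfM⟩ := hq.bounds
  obtain ⟨C, hC, hH⟩ := (hq.div_const hs).setLIntegral_cube_le
    (fun x => (one_le_div hs).2 (hb x).1) ((one_le_div hs).2 hinfm)
  refine ⟨C ^ (1 / s), by positivity, fun z r hr => ?_⟩
  set T := tau q qinf z r with hT
  have hT0 : 0 < T := tau_pos _ _ _ hr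
  have hC0 : 0 < C ^ (1 / s) := by positivity
  have hrn : 0 < r ^ n := by positivity
  rw [mul_comm, ← ENNReal.div_le_iff_le_mul (Or.inl (by simpa using hC0))
    (Or.inl ENNReal.ofReal_ne_top)]
  refine le_sInf ?_
  rintro l ⟨hl0, hltop, hl⟩
  have h1 := hH (fun y => (cubeInd z r y / l) ^ s) (by
    refine le_of_eq_of_le (lintegral_congr fun y => ?_) hl
    rw [← ENNReal.rpow_mul, mul_div_cancel₀ _ hs.ne']) z r hr
  rw [tau_div_const _ _ _ hr, ← hT] at h1
  have h2 : (l⁻¹) ^ s * ENNReal.ofReal (r ^ n) ≤ ENNReal.ofReal (C / T ^ s) *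
      ENNReal.ofReal (r ^ n) := by
    calc _ = ∫⁻ _ in cube z r, (l⁻¹) ^ s := by rw [setLIntegral_const, volume_cube _ hr.le]
      _ = ∫⁻ y in cube z r, (cubeInd z r y / l) ^ s := by
          refine setLIntegral_congr_fun (measurableSet_cube _ _) fun y hy => ?_
          simp only [cubeInd_of_mem hy, one_div]
      _ ≤ ∫⁻ y in cube z (4 * r), (cubeInd z r y / l) ^ s := by
          refine lintegral_mono_set fun y hy i => (hy i).trans (by linarith)
      _ ≤ _ := h1
      _ = _ := by rw [← ENNReal.ofReal_mul (by positivity), div_mul_eq_mul_div]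
  have h3 := (ENNReal.mul_le_mul_iff_left (by simpa using hrn) ENNReal.ofReal_ne_top).1 h2
  have h4 : l⁻¹ ≤ ENNReal.ofReal (C ^ (1 / s) / T) := by
    have h5 := ENNReal.rpow_le_rpow h3 (show 0 ≤ 1 / s by positivity)
    rwa [← ENNReal.rpow_mul, mul_one_div_cancel hs.ne', ENNReal.rpow_one,
      ENNReal.ofReal_rpow_of_pos (by positivity), Real.div_rpow hC.le (by positivity),
      ← Real.rpow_mul hT0.le, mul_one_div_cancel hs.ne', Real.rpow_one] at h5
  have h6 := ENNReal.inv_le_inv.2 h4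
  rwa [inv_inv, ← ENNReal.ofReal_inv_of_pos (by positivity), inv_div,
    ENNReal.ofReal_div_of_pos hC0] at h6

theorem tsum_rpow_rpow_inv_anti {a : ℕ → ℝ≥0∞} {s t : ℝ} (hs : 0 < s) (hst : s ≤ t) :
    (∑' j, a j ^ t) ^ (1 / t) ≤ (∑' j, a j ^ s) ^ (1 / s) := by
  have ht : 0 < t := by linarith
  set S := ∑' j, a j ^ s with hS
  have hk : 0 ≤ t / s - 1 := by rw [sub_nonneg, one_le_div hs]; exact hst
  have hsplit : ∀ u : ℝ≥0∞, u ^ (t / s) = u * u ^ (t / s - 1) := by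
    intro u
    conv_rhs => rw [← ENNReal.rpow_one u, ← ENNReal.rpow_mul, one_mul,
      ← ENNReal.rpow_add_of_nonneg _ _ zero_le_one hk, add_sub_cancel]
  have h : ∑' j, a j ^ t ≤ S ^ (t / s) := by
    calc ∑' j, a j ^ t ≤ ∑' j, a j ^ s * S ^ (t / s - 1) := by
          refine ENNReal.tsum_le_tsum fun j => ?_
          have : a j ^ t = (a j ^ s) ^ (t / s) := by
            rw [← ENNReal.rpow_mul, mul_div_cancel₀ _ hs.ne']
          rw [this, hsplit]
          gcongr
          exact ENNReal.le_tsum (f := fun j => a j ^ s) j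
      _ = S ^ (t / s) := by rw [ENNReal.tsum_mul_right, hsplit]
  calc _ ≤ (S ^ (t / s)) ^ (1 / t) := ENNReal.rpow_le_rpow h (by positivity)
    _ = _ := by
      rw [← ENNReal.rpow_mul]
      congr 1
      field_simp

theorem mul_cubeInd_div_rpow {n : ℕ} {z x : Rn n} {r s : ℝ} (hs : 0 < s) (c N : ℝ≥0∞) :
    (c * cubeInd z r x / N) ^ s = (c / N) ^ s * cubeInd z r x := by
  by_cases hx : x ∈ cube z r
  · rw [cubeInd_of_mem hx, mul_one, mul_one]
  · rw [cubeInd_of_notMem hx, mul_zero, mul_zero, ENNReal.zero_div, ENNReal.zero_rpow_of_pos hs]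

/-- The Sobolev conjugate `q` of a log-Hölder exponent `p` is log-Hölder. -/
theorem LogHolderExp.sobolev_conjugate {n : ℕ} (hn : 0 < n) {p q : Rn n → ℝ} {pinf α m M : ℝ}
    (hp : LogHolderExp p pinf) (hm : 0 < m) (hb : ∀ x, m ≤ p x ∧ p x ≤ M) (hinfm : m ≤ pinf)
    (hinfM : pinf ≤ M) (hα : 0 ≤ α) (hαM : α * M < n) (hq : ∀ x, 1 / q x = 1 / p x - α / n) :
    (∀ x, p x ≤ q x) ∧ ∃ qinf, 1 / qinf = 1 / pinf - α / n ∧ LogHolderExp q qinf := by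
  have hn' : (0 : ℝ) < n := by exact_mod_cast hn
  have hM : 0 < M := by linarith
  set δ := 1 - α * M / n with hδ
  have hδ0 : 0 < δ := by
    have : α * M / n < 1 := by rwa [div_lt_one hn']
    linarith
  have hδle : ∀ c, c ≤ M → δ ≤ 1 - α * c / n := by
    intro c hc
    have : α * c / n ≤ α * M / n := by gcongr
    linarith
  have hle1 : ∀ c, 0 < c → 1 - α * c / n ≤ 1 := by
    intro c hc
    have : 0 ≤ α * c / n := by positivity
    linarith
  set φ : ℝ → ℝ := fun c => c / (1 - α * c / n) with hφ
  have hφinv : ∀ c, m ≤ c → 1 / φ c = 1 / c - α / n := by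
    intro c hc
    have hc0 : 0 < c := by linarith
    rw [hφ, one_div_div]
    field_simp
  have hqφ : ∀ x, q x = φ (p x) := by
    intro x
    rw [← one_div_one_div (q x), hq, ← hφinv _ (hb x).1, one_div_one_div]
  have hφge : ∀ c, m ≤ c → c ≤ M → c ≤ φ c := by
    intro c hc hcM
    have hc0 : 0 < c := by linarith
    exact le_div_self hc0.le (by linarith [hδle c hcM]) (hle1 c hc0)
  have hφle : ∀ c, m ≤ c → c ≤ M → φ c ≤ M / δ := fun c hc hcM =>
    div_le_div₀ hM.le hcM hδ0 (hδle c hcM)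
  have hφlip : ∀ c d, c ≤ M → d ≤ M → |φ c - φ d| ≤ 1 / (δ * δ) * |c - d| := by
    intro c d hcM hdM
    have h1 := hδle c hcM
    have h2 := hδle d hdM
    have h3 : φ c - φ d = 1 / ((1 - α * c / n) * (1 - α * d / n)) * (c - d) := by
      simp only [hφ]
      rw [div_sub_div _ _ (by linarith) (by linarith), one_div_mul_eq_div]
      congr 1
      ring
    have h4 : 0 < (1 - α * c / n) * (1 - α * d / n) := mul_pos (by linarith) (by linarith)
    rw [h3, abs_mul, abs_of_pos (one_div_pos.2 h4)]
    gcongr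
    linarith
  refine ⟨fun x => by rw [hqφ x]; exact hφge _ (hb x).1 (hb x).2, φ pinf, hφinv _ hinfm, ?_⟩
  have hmeas : Measurable q := by
    have : q = fun x => p x / (1 - α * p x / n) := funext hqφ
    rw [this]
    have := hp.measurable
    fun_prop
  refine hp.of_lipschitz hmeas ⟨m, M / δ, hm, fun x => ?_, ?_, hφle _ hinfm hinfM⟩
    (K := 1 / (δ * δ)) (by positivity) (fun x y => ?_) fun x => ?_
  · rw [hqφ x]
    exact ⟨(hb x).1.trans (hφge _ (hb x).1 (hb x).2), hφle _ (hb x).1 (hb x).2⟩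
  · exact hinfm.trans (hφge _ hinfm hinfM)
  · rw [hqφ x, hqφ y]; exact hφlip _ _ (hb x).2 (hb y).2
  · rw [hqφ x]; exact hφlip _ _ (hb x).2 hinfM

theorem exists_varLpNorm_cubeInd_le_mul {n : ℕ} (hn : 0 < n) {p q : Rn n → ℝ} {pinf qinf α : ℝ}
    (hp : LogHolderExp p pinf) (hq : LogHolderExp q qinf)
    (hpq : ∀ x, 1 / q x = 1 / p x - α / n) (hinf : 1 / qinf = 1 / pinf - α / n) :
    ∃ C : ℝ, 0 < C ∧ ∀ (z : Rn n) (r : ℝ), 0 < r →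
      varLpNorm p (cubeInd z r) ≤
        ENNReal.ofReal (C * r ^ α) * varLpNorm q (cubeInd z r) := by
  obtain ⟨C1, hC1, h1⟩ := hp.exists_varLpNorm_cubeInd_le
  obtain ⟨C2, hC2, h2⟩ := hq.exists_le_varLpNorm_cubeInd
  refine ⟨C1 * C2, by positivity, fun z r hr => (h1 z r hr).trans ?_⟩
  have hra : 0 < r ^ α := by positivity
  have ht : C1 * tau p pinf z r = C1 * r ^ α * tau q qinf z r := by
    rw [tau_eq_div_rpow hn (hpq z) hinf hr]; field_simp
  rw [ht, ENNReal.ofReal_mul (by positivity), show C1 * C2 * r ^ α = C1 * r ^ α * C2 by ring,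
    ENNReal.ofReal_mul (p := C1 * r ^ α) (by positivity), mul_assoc]
  gcongr
  exact h2 z r hr

theorem ennreal_div_le_mul_div {a b c k : ℝ≥0∞} (hk : k ≠ 0) (hk' : k ≠ ∞) (h : b ≤ k * c) :
    a / c ≤ k * (a / b) := by
  have h1 : c⁻¹ ≤ k * b⁻¹ := by
    have h2 := ENNReal.inv_le_inv.2 h
    rw [ENNReal.mul_inv (Or.inl hk) (Or.inl hk')] at h2
    calc c⁻¹ = k * (k⁻¹ * c⁻¹) := by rw [← mul_assoc, ENNReal.mul_inv_cancel hk hk', one_mul]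
      _ ≤ _ := by gcongr
  calc a / c = a * c⁻¹ := div_eq_mul_inv _ _
    _ ≤ a * (k * b⁻¹) := by gcongr
    _ = _ := by rw [div_eq_mul_inv, mul_left_comm]

theorem A_functional_q_le_p {n : ℕ} (α : ℝ) (hα0 : 0 ≤ α) (hαn : α < n)
    (p q : Rn n → ℝ) (hp : ∀ x, 0 < p x)
    (hploc : LogHolderLocal p) (hpinf : LogHolderInfty p)
    (hpm : 0 < pMinus p) (hpb : BddAbove (Set.range p)) (hpp : 0 < α → pPlus p < n / α)
    (hq : ∀ x, 1 / q x = 1 / p x - α / n) :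
    ∃ C : ℝ≥0, 0 < C ∧ ∀ (lam : ℕ → ℝ≥0) (z : ℕ → Rn n) (r : ℕ → ℝ), (∀ j, 0 < r j) →
      AFun q lam z r ≤ C * AFun p lam z r := by
  have hn' : (0 : ℝ) < n := hα0.trans_lt hαn
  have hn : 0 < n := by exact_mod_cast hn'
  have hb : ∀ x, pMinus p ≤ p x ∧ p x ≤ pPlus p := fun x =>
    ⟨ciInf_le ⟨0, by rintro _ ⟨y, rfl⟩; exact (hp y).le⟩ x, le_ciSup hpb x⟩
  have hM : 0 < pPlus p := by linarith [(hb 0).1, (hb 0).2]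
  have hαM : α * pPlus p < n := by
    rcases hα0.eq_or_lt with h | h
    · rw [← h, zero_mul]; exact hn'
    · have := hpp h
      rw [lt_div_iff₀ h] at this
      linarith
  obtain ⟨pinf, hinfm, hinfM, hpL⟩ := LogHolderExp.of_logHolder hn hpm hb hploc hpinf
  obtain ⟨hpq, qinf, hqinf, hqL⟩ := hpL.sobolev_conjugate hn hpm hb hinfm hinfM hα0 hαM hq
  set s := pUnder p with hsdef
  have hs : 0 < s := lt_min hpm one_pos
  have hsm : s ≤ pMinus p := min_le_left _ _
  have hqm : pMinus p ≤ pMinus q := le_ciInf fun x => (hb x).1.trans (hpq x)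
  have hss : s ≤ pUnder q := min_le_min_right _ hqm
  obtain ⟨c, hc, hcube⟩ := exists_varLpNorm_cubeInd_le_mul hn hpL hqL hq hqinf
  obtain ⟨V, hV, hmain⟩ := (hpL.div_const hs).exists_lintegral_fractional_le hn
    (Q := fun x => q x / s) (a := α * s) (M := pPlus p / s)
    (fun x => ⟨(one_le_div hs).2 (hsm.trans (hb x).1), by have := (hb x).2; gcongr⟩)
    ⟨(one_le_div hs).2 (hsm.trans hinfm), by gcongr⟩ (by positivity)
    (by rw [mul_assoc, mul_div_cancel₀ _ hs.ne']; exact hαM)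
    (fun x => by
      rw [one_div_div, one_div_div, ← mul_one_div s, hq x]; ring)
  set V' := (max 1 V) ^ (1 / pMinus p) with hV'
  have hV'0 : 0 < V' := by
    have : 0 < max 1 V := lt_max_of_lt_left one_pos
    positivity
  refine ⟨(V' * c).toNNReal, by simpa using mul_pos hV'0 hc, fun lam z r hr => ?_⟩
  change AFun q lam z r ≤ ENNReal.ofReal (V' * c) * AFun p lam z r
  have hK0 : ENNReal.ofReal (V' * c) ≠ 0 := by simpa using mul_pos hV'0 hc
  rw [mul_comm, ← ENNReal.div_le_iff_le_mul (Or.inl hK0) (Or.inl ENNReal.ofReal_ne_top)]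
  refine le_sInf ?_
  rintro l ⟨hl0, hltop, hl⟩
  rw [ENNReal.div_le_iff_le_mul (Or.inl hK0) (Or.inl ENNReal.ofReal_ne_top), mul_comm,
    ENNReal.ofReal_mul hV'0.le, mul_assoc]
  have hcE : ENNReal.ofReal c ≠ 0 := by simpa using hc
  have hcl0 : ENNReal.ofReal c * l ≠ 0 := mul_ne_zero hcE hl0.ne'
  have hclt : ENNReal.ofReal c * l ≠ ∞ := ENNReal.mul_ne_top ENNReal.ofReal_ne_top hltop.ne
  refine varLpNorm_le_of_modular_le hpm (fun x => (hb x).1.trans (hpq x)) (le_max_left _ _)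
    hcl0 hclt ?_
  set b : ℕ → ℝ≥0∞ := fun j => (lam j / varLpNorm p (cubeInd (z j) (r j)) / l) ^ s with hbdef
  have hmod : ∫⁻ x, (∑' j, b j * cubeInd (z j) (r j) x) ^ (p x / s) ≤ 1 := by
    refine le_of_eq_of_le (lintegral_congr fun x => ?_) hl
    have h1 : ∑' j, b j * cubeInd (z j) (r j) x =
        (∑' j, ((lam j : ℝ≥0∞) * cubeInd (z j) (r j) x /
          varLpNorm p (cubeInd (z j) (r j))) ^ s) * (l⁻¹) ^ s := by
      rw [← ENNReal.tsum_mul_right]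
      refine tsum_congr fun j => ?_
      rw [mul_cubeInd_div_rpow hs, hbdef, mul_right_comm, ← ENNReal.mul_rpow_of_nonneg _ _ hs.le,
        ← div_eq_mul_inv]
    rw [h1, div_eq_mul_inv _ l, show p x / s = 1 / s * p x by ring, ENNReal.rpow_mul,
      ENNReal.mul_rpow_of_nonneg _ _ (show 0 ≤ 1 / s by positivity), ← ENNReal.rpow_mul (l⁻¹),
      mul_one_div_cancel hs.ne', ENNReal.rpow_one]
  refine le_trans (lintegral_mono fun x => ?_)
    ((hmain b z r hr hmod).trans (ENNReal.ofReal_le_ofReal (le_max_right _ _)))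
  have hq0 : 0 ≤ q x := (hp x).le.trans (hpq x)
  rw [show q x / s = 1 / s * q x by ring, ENNReal.rpow_mul]
  refine ENNReal.rpow_le_rpow ?_ hq0
  rw [ENNReal.div_le_iff_le_mul (Or.inl hcl0) (Or.inl hclt)]
  refine (tsum_rpow_rpow_inv_anti hs hss).trans ?_
  have hcl : ENNReal.ofReal c * l = ((ENNReal.ofReal c * l) ^ s) ^ (1 / s) := by
    rw [← ENNReal.rpow_mul, mul_one_div_cancel hs.ne', ENNReal.rpow_one]
  rw [hcl, ← ENNReal.mul_rpow_of_nonneg _ _ (show 0 ≤ 1 / s by positivity)]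
  refine ENNReal.rpow_le_rpow ?_ (by positivity)
  rw [← ENNReal.tsum_mul_right]
  refine ENNReal.tsum_le_tsum fun j => ?_
  rw [mul_cubeInd_div_rpow hs, mul_right_comm]
  gcongr
  have hrj : 0 < r j ^ α := Real.rpow_pos_of_pos (hr j) α
  have hk0 : ENNReal.ofReal (c * r j ^ α) ≠ 0 := by simpa using mul_pos hc hrj
  rw [hbdef, Real.rpow_mul (hr j).le, ← ENNReal.ofReal_rpow_of_pos hrj,
    ← ENNReal.mul_rpow_of_nonneg _ _ hs.le, ← ENNReal.mul_rpow_of_nonneg _ _ hs.le]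
  refine ENNReal.rpow_le_rpow ?_ hs.le
  refine (ennreal_div_le_mul_div hk0 ENNReal.ofReal_ne_top (hcube (z j) (r j) (hr j))).trans
    (le_of_eq ?_)
  rw [ENNReal.ofReal_mul hc.le]
  set N : ℝ≥0∞ := lam j / varLpNorm p (cubeInd (z j) (r j))
  have hN : N = N / l * l := (ENNReal.div_mul_cancel hl0.ne' hltop.ne).symm
  conv_lhs => rw [hN]
  ring
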